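/- Compactness of the coupled nonlinear term: let {u_m}, {v_m} be bounded sequences in X₀ with u_m ⇀ u and v_m ⇀ v weakly in X₀. Then lim_{m→∞} ∫_Ω c(x)|u_m|^{α(x)}|v_m|^{β(x)} dx = ∫_Ω c(x)|u|^{α(x)}|v|^{β(x)} dx. -/

import Mathlib

open MeasureTheory Real Set Filter Topology

noncomputable section

abbrev Euc (N : ℕ) := EuclideanSpace ℝ (Fin N)

/-- `Φ⁻ := inf_D Φ`. -/
def infOn {X : Type*} (g : X → ℝ) (D : Set X) : ℝ := sInf (g '' D)

/-- `Φ⁺ := sup_D Φ`. -/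
def supOn {X : Type*} (g : X → ℝ) (D : Set X) : ℝ := sSup (g '' D)

/-- `C₊(D)`: continuous on `D` with `1 < g⁻ ≤ g⁺ < ∞`. -/
def CPlus {X : Type*} [TopologicalSpace X] (D : Set X) (g : X → ℝ) : Prop :=
  ContinuousOn g D ∧ 1 < infOn g D ∧ BddAbove (g '' D)

variable {N : ℕ}

/-- the modular `ρ_γ(u) = ∫_Ω |u|^{γ(x)} dx`. -/
def modular (Ω : Set (Euc N)) (γ u : Euc N → ℝ) : ℝ := ∫ x in Ω, |u x| ^ γ x

/-- membership in the variable exponent Lebesgue space `L^{γ(x)}(Ω)`. -/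
def MemVarLp (Ω : Set (Euc N)) (γ u : Euc N → ℝ) : Prop :=
  AEMeasurable u (volume.restrict Ω) ∧ IntegrableOn (fun x => |u x| ^ γ x) Ω

/-- the Luxemburg norm on `L^{γ(x)}(Ω)`. -/
def luxNorm (Ω : Set (Euc N)) (γ u : Euc N → ℝ) : ℝ :=
  sInf {η : ℝ | 0 < η ∧ (∫ x in Ω, (|u x| / η) ^ γ x) ≤ 1}

/-- the scaled Gagliardo modular over a set `D ⊆ ℝ^N × ℝ^N`. -/
def gagliardoOn (D : Set (Euc N × Euc N)) (s : ℝ) (p : Euc N × Euc N → ℝ)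
    (u : Euc N → ℝ) (η : ℝ) : ℝ :=
  ∫ z in D, |u z.1 - u z.2| ^ p z / (η ^ p z * ‖z.1 - z.2‖ ^ ((N : ℝ) + s * p z))

/-- the seminorm `[u]_Ω^{s,p(x,y)}` of `W`. -/
def Wseminorm (Ω : Set (Euc N)) (s : ℝ) (p : Euc N × Euc N → ℝ) (u : Euc N → ℝ) : ℝ :=
  sInf {η : ℝ | 0 < η ∧ gagliardoOn (Ω ×ˢ Ω) s p u η < 1}

/-- the norm of `W = W^{s,p̄(x),p(x,y)}(Ω)`. -/
def WNorm (Ω : Set (Euc N)) (s : ℝ) (p : Euc N × Euc N → ℝ) (u : Euc N → ℝ) : ℝ :=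
  luxNorm Ω (fun x => p (x, x)) u + Wseminorm Ω s p u

/-- membership in `W = W^{s,p̄(x),p(x,y)}(Ω)`. -/
def MemW (Ω : Set (Euc N)) (s : ℝ) (p : Euc N × Euc N → ℝ) (u : Euc N → ℝ) : Prop :=
  Measurable u ∧ IntegrableOn (fun x => |u x| ^ p (x, x)) Ω ∧
    ∃ η > (0 : ℝ), IntegrableOn
      (fun z : Euc N × Euc N =>
        |u z.1 - u z.2| ^ p z / (η ^ p z * ‖z.1 - z.2‖ ^ ((N : ℝ) + s * p z))) (Ω ×ˢ Ω)

/-- the modular `ρ_{X₀}`. -/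
def rhoX0 (s : ℝ) (p : Euc N × Euc N → ℝ) (u : Euc N → ℝ) : ℝ :=
  ∫ z : Euc N × Euc N, |u z.1 - u z.2| ^ p z / ‖z.1 - z.2‖ ^ ((N : ℝ) + s * p z)

/-- the Luxemburg-type norm of `X₀`. -/
def X0Norm (s : ℝ) (p : Euc N × Euc N → ℝ) (u : Euc N → ℝ) : ℝ :=
  sInf {η : ℝ | 0 < η ∧ gagliardoOn univ s p u η ≤ 1}

/-- membership in `X₀`: vanishing a.e. outside `Ω` and finite scaled Gagliardo modular. -/
def MemX0 (Ω : Set (Euc N)) (s : ℝ) (p : Euc N × Euc N → ℝ) (u : Euc N → ℝ) : Prop :=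
  Measurable u ∧ (∀ᵐ x ∂(volume : Measure (Euc N)), x ∉ Ω → u x = 0) ∧
    ∃ η > (0 : ℝ), Integrable
      (fun z : Euc N × Euc N =>
        |u z.1 - u z.2| ^ p z / (η ^ p z * ‖z.1 - z.2‖ ^ ((N : ℝ) + s * p z)))

/-- the norm `‖(u,v)‖ = max {‖u‖_{X₀}, ‖v‖_{X₀}}` on `E = X₀ × X₀`. -/
def pairNorm (s : ℝ) (p : Euc N × Euc N → ℝ) (u v : Euc N → ℝ) : ℝ :=
  max (X0Norm s p u) (X0Norm s p v)

/-- the critical exponent `p*_s(x) = N p̄(x)/(N − s p̄(x))`. -/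
def pstar (N : ℕ) (s : ℝ) (p : Euc N × Euc N → ℝ) (x : Euc N) : ℝ :=
  (N : ℝ) * p (x, x) / ((N : ℝ) - s * p (x, x))

/-- `P(u,v)`. -/
def Pfun (s : ℝ) (p : Euc N × Euc N → ℝ) (u v : Euc N → ℝ) : ℝ :=
  ∫ z : Euc N × Euc N,
    (|u z.1 - u z.2| ^ p z + |v z.1 - v z.2| ^ p z) / ‖z.1 - z.2‖ ^ ((N : ℝ) + s * p z)

/-- `Q(u,v)`. -/
def Qfun (Ω : Set (Euc N)) (q a b : Euc N → ℝ) (lam mu : ℝ) (u v : Euc N → ℝ) : ℝ :=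
  ∫ x in Ω, (lam * a x * |u x| ^ q x + mu * b x * |v x| ^ q x)

/-- `R(u,v)`. -/
def Rfun (Ω : Set (Euc N)) (α β c : Euc N → ℝ) (u v : Euc N → ℝ) : ℝ :=
  ∫ x in Ω, c x * |u x| ^ α x * |v x| ^ β x

/-- the energy functional `J_{λ,μ}`. -/
def Jfun (Ω : Set (Euc N)) (s : ℝ) (p : Euc N × Euc N → ℝ) (q α β a b c : Euc N → ℝ)
    (lam mu : ℝ) (u v : Euc N → ℝ) : ℝ :=
  (∫ z : Euc N × Euc N,
      (|u z.1 - u z.2| ^ p z + |v z.1 - v z.2| ^ p z) /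
        (p z * ‖z.1 - z.2‖ ^ ((N : ℝ) + s * p z)))
  - (∫ x in Ω, (lam * a x * |u x| ^ q x + mu * b x * |v x| ^ q x) / q x)
  - ∫ x in Ω, c x * |u x| ^ α x * |v x| ^ β x / (α x + β x)

/-- `φ''_{u,v}(1)`, the second derivative at `t = 1` of the fibering map. -/
def phiSecond (Ω : Set (Euc N)) (s : ℝ) (p : Euc N × Euc N → ℝ) (q α β a b c : Euc N → ℝ)
    (lam mu : ℝ) (u v : Euc N → ℝ) : ℝ :=
  (∫ z : Euc N × Euc N,
      (p z - 1) * (|u z.1 - u z.2| ^ p z + |v z.1 - v z.2| ^ p z) /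
        ‖z.1 - z.2‖ ^ ((N : ℝ) + s * p z))
  - (∫ x in Ω, (q x - 1) * (lam * a x * |u x| ^ q x + mu * b x * |v x| ^ q x))
  - ∫ x in Ω, (α x + β x - 1) * (c x * |u x| ^ α x * |v x| ^ β x)

/-- `(u,v) ≠ (0,0)` in `E`. -/
def Nontriv (u v : Euc N → ℝ) : Prop :=
  ¬ (u =ᵐ[(volume : Measure (Euc N))] 0 ∧ v =ᵐ[(volume : Measure (Euc N))] 0)

/-- membership in the Nehari manifold `N_{λ,μ}`:
`⟨J'(u,v),(u,v)⟩ = P(u,v) − Q(u,v) − R(u,v) = 0`. -/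
def InNehari (Ω : Set (Euc N)) (s : ℝ) (p : Euc N × Euc N → ℝ) (q α β a b c : Euc N → ℝ)
    (lam mu : ℝ) (u v : Euc N → ℝ) : Prop :=
  MemX0 Ω s p u ∧ MemX0 Ω s p v ∧ Nontriv u v ∧
    Pfun s p u v - Qfun Ω q a b lam mu u v - Rfun Ω α β c u v = 0

/-- `N⁺_{λ,μ}`. -/
def InNPlus (Ω : Set (Euc N)) (s : ℝ) (p : Euc N × Euc N → ℝ) (q α β a b c : Euc N → ℝ)
    (lam mu : ℝ) (u v : Euc N → ℝ) : Prop :=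
  InNehari Ω s p q α β a b c lam mu u v ∧ 0 < phiSecond Ω s p q α β a b c lam mu u v

/-- `N⁻_{λ,μ}`. -/
def InNMinus (Ω : Set (Euc N)) (s : ℝ) (p : Euc N × Euc N → ℝ) (q α β a b c : Euc N → ℝ)
    (lam mu : ℝ) (u v : Euc N → ℝ) : Prop :=
  InNehari Ω s p q α β a b c lam mu u v ∧ phiSecond Ω s p q α β a b c lam mu u v < 0

/-- `N⁰_{λ,μ}`. -/
def InNZero (Ω : Set (Euc N)) (s : ℝ) (p : Euc N × Euc N → ℝ) (q α β a b c : Euc N → ℝ)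
    (lam mu : ℝ) (u v : Euc N → ℝ) : Prop :=
  InNehari Ω s p q α β a b c lam mu u v ∧ phiSecond Ω s p q α β a b c lam mu u v = 0

/-- `(u,v)` is a weak solution of the system, i.e. `J'_{λ,μ}(u,v) = 0` in the dual of `E`. -/
def IsWeakSolution (Ω : Set (Euc N)) (s : ℝ) (p : Euc N × Euc N → ℝ)
    (q α β a b c : Euc N → ℝ) (lam mu : ℝ) (u v : Euc N → ℝ) : Prop :=
  ∀ φ ψ : Euc N → ℝ, MemX0 Ω s p φ → MemX0 Ω s p ψ →
    ((∫ z : Euc N × Euc N,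
        |u z.1 - u z.2| ^ (p z - 2) * (u z.1 - u z.2) * (φ z.1 - φ z.2) /
          ‖z.1 - z.2‖ ^ ((N : ℝ) + s * p z))
      + ∫ z : Euc N × Euc N,
          |v z.1 - v z.2| ^ (p z - 2) * (v z.1 - v z.2) * (ψ z.1 - ψ z.2) /
            ‖z.1 - z.2‖ ^ ((N : ℝ) + s * p z))
    = (∫ x in Ω, (lam * a x * |u x| ^ (q x - 2) * u x * φ x
        + mu * b x * |v x| ^ (q x - 2) * v x * ψ x))
      + (∫ x in Ω, α x / (α x + β x) * c x * |u x| ^ (α x - 2) * u x * |v x| ^ β x * φ x)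
      + ∫ x in Ω, β x / (α x + β x) * c x * |v x| ^ (α x - 2) * v x * |u x| ^ β x * ψ x

/-- the standing hypotheses: `Ω` a bounded domain, `s ∈ (0,1)`, (P1)–(P2) with `s p⁺ < N`,
and (A1)–(A4). -/
def HypAll (N : ℕ) (Ω : Set (Euc N)) (s : ℝ) (p : Euc N × Euc N → ℝ)
    (q α β a b c : Euc N → ℝ) : Prop :=
  2 ≤ N ∧ IsOpen Ω ∧ Bornology.IsBounded Ω ∧ Ω.Nonempty ∧
  0 < s ∧ s < 1 ∧
  CPlus univ p ∧ (∀ x y : Euc N, p (x, y) = p (y, x)) ∧ s * supOn p univ < (N : ℝ) ∧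
  CPlus (closure Ω) q ∧ CPlus (closure Ω) α ∧ CPlus (closure Ω) β ∧
  supOn q (closure Ω) < infOn p univ ∧
  supOn p univ < infOn α (closure Ω) + infOn β (closure Ω) ∧
  supOn α (closure Ω) + supOn β (closure Ω) < infOn (pstar N s p) (closure Ω) ∧
  infOn p univ / (supOn α (closure Ω) + supOn β (closure Ω)) <
    (infOn p univ - supOn q (closure Ω)) /
        (supOn α (closure Ω) + supOn β (closure Ω) - supOn q (closure Ω)) *
      ((infOn α (closure Ω) + infOn β (closure Ω) - infOn q (closure Ω)) /
        (supOn p univ - infOn q (closure Ω))) ∧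
  Measurable a ∧ Measurable b ∧ Measurable c ∧
  (∀ x, 0 ≤ a x) ∧ (∀ x, 0 ≤ b x) ∧ (∀ x, 0 ≤ c x) ∧
  MemVarLp Ω (fun x => (α x + β x) / (α x + β x - q x)) a ∧
  MemVarLp Ω (fun x => (α x + β x) / (α x + β x - q x)) b ∧
  (∃ M : ℝ, ∀ x, c x ≤ M)

/-- the estimate `Q(u,v) ≤ C₁(λ+μ)·max{‖(u,v)‖^{q⁻},‖(u,v)‖^{q⁺}}`. -/
def QEstimate (Ω : Set (Euc N)) (s : ℝ) (p : Euc N × Euc N → ℝ) (q a b : Euc N → ℝ)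
    (C₁ : ℝ) : Prop :=
  ∀ lam mu : ℝ, 0 < lam → 0 < mu → ∀ u v : Euc N → ℝ,
    MemX0 Ω s p u → MemX0 Ω s p v →
      Qfun Ω q a b lam mu u v ≤ C₁ * (lam + mu) *
        max (pairNorm s p u v ^ infOn q (closure Ω))
          (pairNorm s p u v ^ supOn q (closure Ω))

/-- the estimate `R(u,v) ≤ C₂·max{‖(u,v)‖^{α⁻+β⁻},‖(u,v)‖^{α⁺+β⁺}}`. -/
def REstimate (Ω : Set (Euc N)) (s : ℝ) (p : Euc N × Euc N → ℝ) (α β c : Euc N → ℝ)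
    (C₂ : ℝ) : Prop :=
  ∀ u v : Euc N → ℝ, MemX0 Ω s p u → MemX0 Ω s p v →
    Rfun Ω α β c u v ≤ C₂ *
      max (pairNorm s p u v ^ (infOn α (closure Ω) + infOn β (closure Ω)))
        (pairNorm s p u v ^ (supOn α (closure Ω) + supOn β (closure Ω)))

/-- the threshold
`δ = (1/C₁)·[(α⁻+β⁻−p⁺)/(α⁻+β⁻−q⁻)]·[(p⁻−q⁺)/(C₂(α⁺+β⁺−q⁺))]^{(p⁺−q⁻)/(α⁻+β⁻−p⁺)}`. -/
def deltaConst (Ω : Set (Euc N)) (p : Euc N × Euc N → ℝ) (q α β : Euc N → ℝ)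
    (C₁ C₂ : ℝ) : ℝ :=
  (1 / C₁) *
    ((infOn α (closure Ω) + infOn β (closure Ω) - supOn p univ) /
      (infOn α (closure Ω) + infOn β (closure Ω) - infOn q (closure Ω))) *
    ((infOn p univ - supOn q (closure Ω)) /
        (C₂ * (supOn α (closure Ω) + supOn β (closure Ω) - supOn q (closure Ω)))) ^
      ((supOn p univ - infOn q (closure Ω)) /
        (infOn α (closure Ω) + infOn β (closure Ω) - supOn p univ))

/-- scaling `t·u`. -/
def scale (t : ℝ) (u : Euc N → ℝ) : Euc N → ℝ := fun x => t * u x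

/-- weak convergence `u_m ⇀ u` in `X₀`, tested through the isometric embedding
`u ↦ (u(x)−u(y))` of `X₀` into `L^{p(x,y)}(dx dy/|x−y|^{N+sp(x,y)})`. -/
def WeakTendstoX0 (s : ℝ) (p : Euc N × Euc N → ℝ) (um : ℕ → Euc N → ℝ)
    (u : Euc N → ℝ) : Prop :=
  ∀ g : Euc N × Euc N → ℝ, Measurable g →
    Integrable (fun z : Euc N × Euc N =>
      |g z| ^ (p z / (p z - 1)) / ‖z.1 - z.2‖ ^ ((N : ℝ) + s * p z)) →
    Tendsto (fun m => ∫ z : Euc N × Euc N,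
        (um m z.1 - um m z.2) * g z / ‖z.1 - z.2‖ ^ ((N : ℝ) + s * p z)) atTop
      (𝓝 (∫ z : Euc N × Euc N, (u z.1 - u z.2) * g z / ‖z.1 - z.2‖ ^ ((N : ℝ) + s * p z)))

section VariableExponent

theorem CPlus.infOn_le {X : Type*} [TopologicalSpace X] {D : Set X} {g : X → ℝ}
    (h : CPlus D g) {x : X} (hx : x ∈ D) : infOn g D ≤ g x := by
  refine csInf_le ?_ (mem_image_of_mem g hx)
  by_contra hb
  have h1 := h.2.1
  rw [infOn, Real.sInf_of_not_bddBelow hb] at h1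
  linarith

theorem CPlus.one_lt {X : Type*} [TopologicalSpace X] {D : Set X} {g : X → ℝ}
    (h : CPlus D g) {x : X} (hx : x ∈ D) : 1 < g x :=
  h.2.1.trans_le (h.infOn_le hx)

theorem CPlus.le_supOn {X : Type*} [TopologicalSpace X] {D : Set X} {g : X → ℝ}
    (h : CPlus D g) {x : X} (hx : x ∈ D) : g x ≤ supOn g D :=
  le_csSup h.2.2 (mem_image_of_mem g hx)

/-- the integrand of the modular `ρ_{X₀}`. -/
def fracDensity (s : ℝ) (p : Euc N × Euc N → ℝ) (u : Euc N → ℝ) (z : Euc N × Euc N) : ℝ :=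
  |u z.1 - u z.2| ^ p z / ‖z.1 - z.2‖ ^ ((N : ℝ) + s * p z)

/-- the modular `ρ_{X₀}` as an extended nonnegative number. -/
def fracEnergy (s : ℝ) (p : Euc N × Euc N → ℝ) (u : Euc N → ℝ) : ENNReal :=
  ∫⁻ z, ENNReal.ofReal (fracDensity s p u z)

theorem fracDensity_nonneg (s : ℝ) (p : Euc N × Euc N → ℝ) (u : Euc N → ℝ)
    (z : Euc N × Euc N) : 0 ≤ fracDensity s p u z := by
  unfold fracDensity; positivity

theorem measurable_fracDensity {s : ℝ} {p : Euc N × Euc N → ℝ} (hp : Measurable p)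
    {u : Euc N → ℝ} (hu : Measurable u) : Measurable (fracDensity s p u) := by
  unfold fracDensity; fun_prop

theorem CPlus.continuous {X : Type*} [TopologicalSpace X] {g : X → ℝ}
    (h : CPlus univ g) : Continuous g :=
  continuousOn_univ.1 h.1

theorem gagliardo_integrand_eq (s : ℝ) (p : Euc N × Euc N → ℝ) (u : Euc N → ℝ) (η : ℝ)
    (z : Euc N × Euc N) :
    |u z.1 - u z.2| ^ p z / (η ^ p z * ‖z.1 - z.2‖ ^ ((N : ℝ) + s * p z)) =
      (η ^ p z)⁻¹ * fracDensity s p u z := by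
  rw [fracDensity, mul_comm (η ^ p z), ← div_div, div_eq_inv_mul]

theorem integrable_fracDensity {Ω : Set (Euc N)} {s : ℝ} {p : Euc N × Euc N → ℝ}
    (hp : CPlus univ p) {u : Euc N → ℝ} (hu : MemX0 Ω s p u) :
    Integrable (fracDensity s p u) := by
  obtain ⟨hum, -, η, hη, hi⟩ := hu
  simp_rw [gagliardo_integrand_eq] at hi
  refine Integrable.mono' (hi.const_mul ((max η 1) ^ supOn p univ))
    (measurable_fracDensity hp.continuous.measurable hum).aestronglyMeasurable
    (Eventually.of_forall fun z => ?_)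
  have h0 := fracDensity_nonneg s p u z
  have hpz : 1 < p z := hp.one_lt (mem_univ z)
  have hηp : 0 < η ^ p z := rpow_pos_of_pos hη _
  have h1 : η ^ p z ≤ (max η 1) ^ supOn p univ :=
    (rpow_le_rpow hη.le (le_max_left _ _) (by linarith)).trans
      (rpow_le_rpow_of_exponent_le (le_max_right _ _) (hp.le_supOn (mem_univ z)))
  rw [norm_of_nonneg h0]
  calc fracDensity s p u z = η ^ p z * ((η ^ p z)⁻¹ * fracDensity s p u z) := by
        field_simp
    _ ≤ _ := by gcongr

theorem fracEnergy_eq_ofReal {Ω : Set (Euc N)} {s : ℝ} {p : Euc N × Euc N → ℝ}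
    (hp : CPlus univ p) {u : Euc N → ℝ} (hu : MemX0 Ω s p u) :
    fracEnergy s p u = ENNReal.ofReal (∫ z, fracDensity s p u z) :=
  (ofReal_integral_eq_lintegral_ofReal (integrable_fracDensity hp hu)
    (Eventually.of_forall (fracDensity_nonneg s p u))).symm

/-- A bound on the Luxemburg norm bounds the modular. -/
theorem fracEnergy_le_of_X0Norm_le {Ω : Set (Euc N)} {s : ℝ} {p : Euc N × Euc N → ℝ}
    (hp : CPlus univ p) {u : Euc N → ℝ} (hu : MemX0 Ω s p u) {B : ℝ} (hB : 1 ≤ B)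
    (h : X0Norm s p u < B) : fracEnergy s p u ≤ ENNReal.ofReal (B ^ supOn p univ) := by
  have hF := integrable_fracDensity hp hu
  have hF0 : 0 ≤ ∫ z, fracDensity s p u z := integral_nonneg (fracDensity_nonneg s p u)
  have hint : ∀ η : ℝ, 1 ≤ η → Integrable (fun z => (η ^ p z)⁻¹ * fracDensity s p u z) := by
    intro η hη
    refine hF.mono' ?_ (Eventually.of_forall fun z => ?_)
    · have := measurable_fracDensity (s := s) hp.continuous.measurable hu.1
      have := hp.continuous.measurable
      exact Measurable.aestronglyMeasurable (by fun_prop)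
    · have h0 := fracDensity_nonneg s p u z
      have hpz : 1 < p z := hp.one_lt (mem_univ z)
      rw [norm_of_nonneg (by positivity)]
      exact mul_le_of_le_one_left h0 (inv_le_one_of_one_le₀ (one_le_rpow hη (by linarith)))
  have hne : {η : ℝ | 0 < η ∧ gagliardoOn univ s p u η ≤ 1}.Nonempty := by
    refine ⟨1 + ∫ z, fracDensity s p u z, by positivity, ?_⟩
    set η := 1 + ∫ z, fracDensity s p u z with hη
    have hη1 : 1 ≤ η := by linarith
    simp_rw [gagliardoOn, gagliardo_integrand_eq, setIntegral_univ]
    calc ∫ z, (η ^ p z)⁻¹ * fracDensity s p u z ≤ ∫ z, η⁻¹ * fracDensity s p u z := by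
          refine integral_mono (hint η hη1) (hF.const_mul _) fun z => ?_
          have h0 := fracDensity_nonneg s p u z
          have hpz : 1 < p z := hp.one_lt (mem_univ z)
          have := rpow_le_rpow_of_exponent_le hη1 hpz.le
          rw [rpow_one] at this
          dsimp only
          gcongr
      _ = η⁻¹ * ∫ z, fracDensity s p u z := integral_const_mul _ _
      _ ≤ 1 := by
          rw [inv_mul_le_iff₀ (by linarith)]; linarith
  obtain ⟨η, ⟨hη0, hη⟩, hηB⟩ := exists_lt_of_csInf_lt hne h
  rw [fracEnergy_eq_ofReal hp hu]
  refine ENNReal.ofReal_le_ofReal ?_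
  simp_rw [gagliardoOn, gagliardo_integrand_eq, setIntegral_univ] at hη
  have hηint : Integrable (fun z => (η ^ p z)⁻¹ * fracDensity s p u z) := by
    refine Integrable.mono' (hF.const_mul ((max η⁻¹ 1) ^ supOn p univ)) ?_
      (Eventually.of_forall fun z => ?_)
    · have := measurable_fracDensity (s := s) hp.continuous.measurable hu.1
      have := hp.continuous.measurable
      exact Measurable.aestronglyMeasurable (by fun_prop)
    · have h0 := fracDensity_nonneg s p u z
      have hpz : 1 < p z := hp.one_lt (mem_univ z)
      rw [norm_of_nonneg (by positivity)]
      gcongr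
      rw [← inv_rpow hη0.le]
      exact (rpow_le_rpow (by positivity) (le_max_left _ _) (by linarith)).trans
        (rpow_le_rpow_of_exponent_le (le_max_right _ _) (hp.le_supOn (mem_univ z)))
  calc ∫ z, fracDensity s p u z
      ≤ ∫ z, B ^ supOn p univ * ((η ^ p z)⁻¹ * fracDensity s p u z) := by
        refine integral_mono hF (hηint.const_mul _) fun z => ?_
        have h0 := fracDensity_nonneg s p u z
        have hpz : 1 < p z := hp.one_lt (mem_univ z)
        have hηp : 0 < η ^ p z := rpow_pos_of_pos hη0 _
        have h1 : η ^ p z ≤ B ^ supOn p univ :=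
          (rpow_le_rpow hη0.le hηB.le (by linarith)).trans
            (rpow_le_rpow_of_exponent_le hB (hp.le_supOn (mem_univ z)))
        calc fracDensity s p u z = η ^ p z * ((η ^ p z)⁻¹ * fracDensity s p u z) := by
              field_simp
          _ ≤ _ := by gcongr
    _ = B ^ supOn p univ * ∫ z, (η ^ p z)⁻¹ * fracDensity s p u z := integral_const_mul _ _
    _ ≤ B ^ supOn p univ := mul_le_of_le_one_right (by positivity) hη

theorem fracEnergy_sub_le {s : ℝ} {p : Euc N × Euc N → ℝ} (hp : CPlus univ p)
    {u v : Euc N → ℝ} (hu : Measurable u) (hv : Measurable v) :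
    fracEnergy s p (fun x => u x - v x) ≤
      ENNReal.ofReal (2 ^ supOn p univ) * (fracEnergy s p u + fracEnergy s p v) := by
  have hmu := measurable_fracDensity (s := s) hp.continuous.measurable hu
  have hmv := measurable_fracDensity (s := s) hp.continuous.measurable hv
  rw [fracEnergy, fracEnergy, fracEnergy, ← lintegral_add_left (by fun_prop),
    ← lintegral_const_mul _ (by fun_prop)]
  refine lintegral_mono fun z => ?_
  have hpz : 1 < p z := hp.one_lt (mem_univ z)
  rw [← ENNReal.ofReal_add (fracDensity_nonneg ..) (fracDensity_nonneg ..),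
    ← ENNReal.ofReal_mul (by positivity)]
  refine ENNReal.ofReal_le_ofReal ?_
  unfold fracDensity
  rw [← add_div, ← mul_div_assoc]
  gcongr
  set a := |u z.1 - u z.2|
  set b := |v z.1 - v z.2|
  have ha : 0 ≤ a := abs_nonneg _
  have hb : 0 ≤ b := abs_nonneg _
  have h1 : |u z.1 - v z.1 - (u z.2 - v z.2)| ≤ 2 * max a b := by
    have : u z.1 - v z.1 - (u z.2 - v z.2) = (u z.1 - u z.2) - (v z.1 - v z.2) := by ring
    rw [this]
    have := abs_sub (u z.1 - u z.2) (v z.1 - v z.2)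
    have := le_max_left a b
    have := le_max_right a b
    linarith
  have h2 : (max a b) ^ p z ≤ a ^ p z + b ^ p z := by
    rcases max_cases a b with h | h <;> rw [h.1]
    · have := rpow_nonneg hb (p z); linarith
    · have := rpow_nonneg ha (p z); linarith
  calc |u z.1 - v z.1 - (u z.2 - v z.2)| ^ p z ≤ (2 * max a b) ^ p z := by gcongr
    _ = 2 ^ p z * (max a b) ^ p z := mul_rpow (by norm_num) (le_max_of_le_left ha)
    _ ≤ 2 ^ supOn p univ * (a ^ p z + b ^ p z) := by
        gcongr
        · norm_num
        · exact hp.le_supOn (mem_univ z)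

end VariableExponent

section WeakType

theorem div_pow_le_of_le_mul {d r h T s q P : ℝ} (hr : 0 < r) (hrh : r ≤ h) (hT : 1 ≤ T)
    (hd : T * h ^ s ≤ d) (hPq : P ≤ q) (hs : 0 ≤ s) (hq : 0 ≤ q) :
    T ^ P / h ^ N ≤ d ^ q / r ^ ((N : ℝ) + s * q) := by
  have hh : 0 < h := hr.trans_le hrh
  have hT0 : 0 < T := by linarith
  have h1 : T ^ P * h ^ (s * q) ≤ d ^ q := calc
    T ^ P * h ^ (s * q) ≤ T ^ q * h ^ (s * q) := by gcongr
    _ = (T * h ^ s) ^ q := by rw [mul_rpow hT0.le (by positivity), ← rpow_mul hh.le]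
    _ ≤ d ^ q := by gcongr
  have h2 : r ^ ((N : ℝ) + s * q) ≤ h ^ N * h ^ (s * q) := calc
    r ^ ((N : ℝ) + s * q) ≤ h ^ ((N : ℝ) + s * q) := by gcongr
    _ = _ := by rw [rpow_add hh, rpow_natCast]
  calc T ^ P / h ^ N = (T ^ P * h ^ (s * q)) / (h ^ N * h ^ (s * q)) := by
        field_simp
    _ ≤ d ^ q / r ^ ((N : ℝ) + s * q) := by
        have : 0 ≤ d ^ q := le_trans (by positivity) h1
        gcongr

theorem volume_ball_eq_ofReal (x : Euc N) {h : ℝ} (hh : 0 < h) :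
    volume (Metric.ball x h) =
      ENNReal.ofReal (h ^ N * volume.real (Metric.ball (0 : Euc N) 1)) := by
  rw [Measure.addHaar_ball_of_pos _ _ hh, ENNReal.ofReal_mul (by positivity), measureReal_def,
    ENNReal.ofReal_toReal measure_ball_lt_top.ne]
  simp

theorem volume_ball_div_two (x : Euc N) {h : ℝ} (hh : 0 < h) :
    volume (Metric.ball x h) / 2 =
      ENNReal.ofReal (h ^ N * volume.real (Metric.ball (0 : Euc N) 1) / 2) := by
  rw [volume_ball_eq_ofReal x hh, ENNReal.ofReal_div_of_pos two_pos, ENNReal.ofReal_ofNat]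

theorem volume_real_unitBall_pos : 0 < volume.real (Metric.ball (0 : Euc N) 1) :=
  ENNReal.toReal_pos (Metric.measure_ball_pos _ _ one_pos).ne' measure_ball_lt_top.ne

theorem fracEnergy_eq_lintegral_lintegral {s : ℝ} {p : Euc N × Euc N → ℝ} (hp : CPlus univ p)
    {u : Euc N → ℝ} (hu : Measurable u) :
    fracEnergy s p u = ∫⁻ x, ∫⁻ y, ENNReal.ofReal (fracDensity s p u (x, y)) := by
  have := measurable_fracDensity (s := s) hp.continuous.measurable hu
  rw [fracEnergy, Measure.volume_eq_prod, lintegral_prod _ (by fun_prop)]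

/-- A Chebyshev type inequality for sets on which the inner integral of the energy is large. -/
theorem ofReal_mul_volume_le_fracEnergy {s : ℝ} {p : Euc N × Euc N → ℝ} (hp : CPlus univ p)
    {u : Euc N → ℝ} (hu : Measurable u) {k : ℝ} {S : Set (Euc N)}
    (hS : ∀ᵐ x, x ∈ S →
      ENNReal.ofReal k ≤ ∫⁻ y, ENNReal.ofReal (fracDensity s p u (x, y))) :
    ENNReal.ofReal k * volume S ≤ fracEnergy s p u := by
  have := measurable_fracDensity (s := s) hp.continuous.measurable hu
  rw [fracEnergy_eq_lintegral_lintegral hp hu]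
  refine le_trans ?_ (mul_meas_ge_le_lintegral
    (f := fun x => ∫⁻ y, ENNReal.ofReal (fracDensity s p u (x, y))) ?_ (ENNReal.ofReal k))
  · exact mul_le_mul_right (measure_mono_ae hS) _
  · exact Measurable.lintegral_prod_right' (f := fun z => ENNReal.ofReal (fracDensity s p u z))
      (by fun_prop)

theorem le_ofReal_inv_mul_of_ofReal_mul_le {a b : ENNReal} {k : ℝ} (hk : 0 < k)
    (h : ENNReal.ofReal k * a ≤ b) : a ≤ ENNReal.ofReal k⁻¹ * b := by
  have h0 : ENNReal.ofReal k⁻¹ * ENNReal.ofReal k = 1 := by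
    rw [← ENNReal.ofReal_mul (by positivity), inv_mul_cancel₀ hk.ne', ENNReal.ofReal_one]
  calc a = ENNReal.ofReal k⁻¹ * (ENNReal.ofReal k * a) := by rw [← mul_assoc, h0, one_mul]
    _ ≤ _ := by gcongr

/-- If the superlevel set at height `lam / 2` fills at most half of a ball of radius `h`, the
superlevel set at height `lam` is controlled by the energy. -/
theorem volume_superlevel_le_fracEnergy {Ω : Set (Euc N)} {s : ℝ} (hs : 0 ≤ s)
    {p : Euc N × Euc N → ℝ} (hp : CPlus univ p) {u : Euc N → ℝ} (hu : Measurable u)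
    (hu0 : ∀ᵐ x, x ∉ Ω → u x = 0) {P h lam : ℝ} (hh : 0 < h) (hlam : 2 * h ^ s ≤ lam)
    (hloc : ∀ x ∈ Ω, ∀ y, dist x y < h → P ≤ p (x, y))
    (hsmall : volume {y | lam / 2 < |u y|} ≤ volume (Metric.ball (0 : Euc N) h) / 2) :
    volume {x | lam < |u x|} ≤
      ENNReal.ofReal (2 / volume.real (Metric.ball (0 : Euc N) 1) * (2 * h ^ s / lam) ^ P) *
        fracEnergy s p u := by
  set ω := volume.real (Metric.ball (0 : Euc N) 1) with hω
  have hω0 : 0 < ω := volume_real_unitBall_pos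
  have hhs : 0 < h ^ s := rpow_pos_of_pos hh s
  have hlam0 : 0 < lam := by linarith
  set T := lam / (2 * h ^ s) with hT
  have hT1 : 1 ≤ T := (one_le_div (by positivity)).2 hlam
  have hT0 : 0 < T := by linarith
  have hk : 2 / ω * (2 * h ^ s / lam) ^ P = (T ^ P / h ^ N * (h ^ N * ω / 2))⁻¹ := by
    have : 2 * h ^ s / lam = T⁻¹ := by rw [hT, inv_div]
    rw [this, inv_rpow hT0.le]
    field_simp
  rw [hk]
  refine le_ofReal_inv_mul_of_ofReal_mul_le (by positivity)
    (ofReal_mul_volume_le_fracEnergy hp hu ?_)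
  filter_upwards [hu0] with x hx0 hx
  have hx : lam < |u x| := hx
  have hxΩ : x ∈ Ω := by
    by_contra hn
    rw [hx0 hn, abs_zero] at hx
    linarith
  set G := Metric.ball x h ∩ {y | |u y| ≤ lam / 2} with hG
  have hGm : MeasurableSet G :=
    measurableSet_ball.inter (measurableSet_le (by fun_prop) measurable_const)
  have hvol : ENNReal.ofReal (h ^ N * ω / 2) ≤ volume G := by
    have hb : volume (Metric.ball x h) = volume (Metric.ball (0 : Euc N) h) := by
      rw [volume_ball_eq_ofReal x hh, volume_ball_eq_ofReal 0 hh]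
    have h1 : volume (Metric.ball x h) ≤ volume G + volume (Metric.ball x h) / 2 := by
      refine (measure_mono (t := G ∪ {y | lam / 2 < |u y|}) fun y hy => ?_).trans
        ((measure_union_le _ _).trans (by rw [hb]; gcongr))
      rcases le_or_gt |u y| (lam / 2) with h' | h'
      · exact Or.inl ⟨hy, h'⟩
      · exact Or.inr h'
    have h2 : volume (Metric.ball x h) / 2 ≤ volume G := by
      have hfin : volume (Metric.ball x h) / 2 ≠ ⊤ :=
        ENNReal.div_ne_top measure_ball_lt_top.ne (by norm_num)
      refine (ENNReal.add_le_add_iff_right hfin).1 ?_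
      rwa [ENNReal.add_halves]
    rwa [volume_ball_div_two x hh] at h2
  calc ENNReal.ofReal (T ^ P / h ^ N * (h ^ N * ω / 2))
      = ENNReal.ofReal (T ^ P / h ^ N) * ENNReal.ofReal (h ^ N * ω / 2) :=
        ENNReal.ofReal_mul (by positivity)
    _ ≤ ENNReal.ofReal (T ^ P / h ^ N) * volume G := by gcongr
    _ = ∫⁻ y in G, ENNReal.ofReal (T ^ P / h ^ N) := (setLIntegral_const _ _).symm
    _ ≤ ∫⁻ y in G, ENNReal.ofReal (fracDensity s p u (x, y)) := by
        refine setLIntegral_mono' hGm fun y hy => ENNReal.ofReal_le_ofReal ?_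
        have hd : lam / 2 ≤ |u x - u y| := by
          have h1 := abs_sub_abs_le_abs_sub (u x) (u y)
          have h2 : |u y| ≤ lam / 2 := hy.2
          linarith
        have hxy : dist x y < h := by rw [dist_comm]; exact hy.1
        have hr : 0 < ‖x - y‖ := by
          rw [norm_pos_iff, sub_ne_zero]
          rintro rfl
          simp at hd
          linarith
        have hpxy := hp.one_lt (mem_univ (x, y))
        refine div_pow_le_of_le_mul hr ?_ hT1 (le_of_eq_of_le ?_ hd) (hloc x hxΩ y hxy) hs
          (by linarith)
        · rw [← dist_eq_norm]; exact hxy.le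
        · rw [hT]; field_simp
    _ ≤ ∫⁻ y, ENNReal.ofReal (fracDensity s p u (x, y)) := setLIntegral_le_lintegral _ _

theorem volume_superlevel_le {Ω : Set (Euc N)} {u : Euc N → ℝ}
    (hu0 : ∀ᵐ x, x ∉ Ω → u x = 0) {lam : ℝ} (hlam : 0 ≤ lam) :
    volume {x | lam < |u x|} ≤ volume Ω := by
  refine measure_mono_ae ?_
  filter_upwards [hu0] with x hx0 hx
  by_contra hn
  have hx : lam < |u x| := hx
  rw [hx0 hn, abs_zero] at hx
  linarith

/-- uniform weak `L^q` bound for functions vanishing outside `Ω` with energy at most `M`. -/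
def WeakTypeBound (Ω : Set (Euc N)) (s : ℝ) (p : Euc N × Euc N → ℝ) (M q : ℝ) : Prop :=
  ∃ C : ℝ, 0 < C ∧ ∀ u : Euc N → ℝ, Measurable u → (∀ᵐ x, x ∉ Ω → u x = 0) →
    fracEnergy s p u ≤ ENNReal.ofReal M → ∀ lam : ℝ, 1 ≤ lam →
      volume {x | lam < |u x|} ≤ ENNReal.ofReal (C * lam ^ (-q))

theorem WeakTypeBound.of_eventually {Ω : Set (Euc N)} (hΩ : volume Ω ≠ ⊤) {s : ℝ}
    {p : Euc N × Euc N → ℝ} {M q : ℝ} (hq : 0 ≤ q) (C L : ℝ)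
    (h : ∀ u : Euc N → ℝ, Measurable u → (∀ᵐ x, x ∉ Ω → u x = 0) →
      fracEnergy s p u ≤ ENNReal.ofReal M → ∀ lam : ℝ, L ≤ lam →
        volume {x | lam < |u x|} ≤ ENNReal.ofReal (C * lam ^ (-q))) :
    WeakTypeBound Ω s p M q := by
  have hV : 0 ≤ volume.real Ω := measureReal_nonneg
  set K := (volume.real Ω + 1) * (max L 1) ^ q with hK
  have hL1 : 1 ≤ max L 1 := le_max_right _ _
  have hK0 : 0 < K := by positivity
  refine ⟨max C 0 + K, by positivity, fun u hu hu0 hM lam hlam => ?_⟩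
  have hl : 0 < lam ^ (-q) := rpow_pos_of_pos (by linarith) _
  rcases le_or_gt L lam with hL | hL
  · refine (h u hu hu0 hM lam hL).trans (ENNReal.ofReal_le_ofReal ?_)
    gcongr
    exact (le_max_left C 0).trans (by linarith)
  · refine (volume_superlevel_le hu0 (by linarith)).trans ?_
    rw [← ENNReal.ofReal_toReal hΩ]
    refine ENNReal.ofReal_le_ofReal ?_
    have h1 : 1 ≤ (max L 1) ^ q * lam ^ (-q) := by
      rw [rpow_neg (by linarith), ← div_eq_mul_inv, one_le_div (by positivity)]
      exact rpow_le_rpow (by linarith) (hL.le.trans (le_max_left _ _)) hq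
    calc (volume Ω).toReal ≤ (volume.real Ω + 1) * 1 := by rw [measureReal_def]; linarith
      _ ≤ (volume.real Ω + 1) * ((max L 1) ^ q * lam ^ (-q)) := by gcongr
      _ = K * lam ^ (-q) := by rw [hK]; ring
      _ ≤ _ := by gcongr; linarith [le_max_right C 0]

theorem weakTypeBound_one (hN : N ≠ 0) {Ω : Set (Euc N)} (hΩ : volume Ω ≠ ⊤) {s : ℝ}
    (hs : 0 ≤ s) {p : Euc N × Euc N → ℝ} (hp : CPlus univ p) (M : ℝ) :
    WeakTypeBound Ω s p M 1 := by
  set ω := volume.real (Metric.ball (0 : Euc N) 1) with hω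
  have hω0 : 0 < ω := volume_real_unitBall_pos
  set h := max 1 (2 * volume.real Ω / ω) with hh
  have hh1 : 1 ≤ h := le_max_left _ _
  have hball : volume Ω ≤ volume (Metric.ball (0 : Euc N) h) / 2 := by
    rw [volume_ball_div_two 0 (by linarith), ← ENNReal.ofReal_toReal hΩ]
    refine ENNReal.ofReal_le_ofReal ?_
    have h1 : 2 * volume.real Ω / ω ≤ h ^ N :=
      (le_max_right _ _).trans (le_self_pow₀ hh1 hN)
    rw [div_le_iff₀ hω0] at h1
    rw [← measureReal_def]
    linarith
  refine WeakTypeBound.of_eventually hΩ zero_le_one (2 / ω * (2 * h ^ s) * M) (2 * h ^ s)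
    fun u hu hu0 hM lam hlam => ?_
  have hhs : 0 < h ^ s := rpow_pos_of_pos (by linarith) s
  have hlam0 : 0 < lam := by linarith
  refine (volume_superlevel_le_fracEnergy (P := 1) hs hp hu hu0 (by linarith) hlam
    (fun x _ y _ => (hp.one_lt (mem_univ (x, y))).le)
    ((volume_superlevel_le hu0 (by linarith)).trans hball)).trans ?_
  refine (mul_le_mul_right hM _).trans ?_
  rw [← ENNReal.ofReal_mul (by positivity)]
  refine ENNReal.ofReal_le_ofReal (le_of_eq ?_)
  rw [rpow_one, rpow_neg_one]
  ring

theorem WeakTypeBound.step (hN : N ≠ 0) {Ω : Set (Euc N)} (hΩ : volume Ω ≠ ⊤) {s : ℝ}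
    (hs : 0 ≤ s) {p : Euc N × Euc N → ℝ} (hp : CPlus univ p) {M q P δ : ℝ} (hq : 0 < q)
    (hP : 0 ≤ P) (hδ : 0 < δ) (hloc : ∀ x ∈ Ω, ∀ y, dist x y < δ → P ≤ p (x, y))
    (hw : WeakTypeBound Ω s p M q) : WeakTypeBound Ω s p M (P + s * P / N * q) := by
  obtain ⟨C, hC, hw⟩ := hw
  set ω := volume.real (Metric.ball (0 : Euc N) 1) with hω
  have hω0 : 0 < ω := volume_real_unitBall_pos
  have hN0 : 0 < (N : ℝ) := by positivity
  set K := 2 * C * 2 ^ q / ω with hK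
  have hK0 : 0 < K := by positivity
  have hlim : Tendsto (fun lam : ℝ => (K * lam ^ (-q)) ^ (1 / (N : ℝ))) atTop (𝓝 0) := by
    have h1 := ((tendsto_rpow_neg_atTop hq).const_mul K).rpow_const (p := 1 / (N : ℝ))
      (Or.inr (by positivity))
    rwa [mul_zero, zero_rpow (by positivity)] at h1
  obtain ⟨L, hL⟩ := eventually_atTop.1 ((eventually_ge_atTop 2).and
    (hlim.eventually_lt_const (lt_min hδ one_pos)))
  refine WeakTypeBound.of_eventually hΩ (by positivity)
    (2 / ω * (2 ^ P * K ^ (s * P / N)) * M) L fun u hu hu0 hM lam hlam => ?_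
  obtain ⟨hlam2, hlt⟩ := hL lam hlam
  have hlam0 : 0 < lam := by linarith
  have hlq : 0 < lam ^ (-q) := rpow_pos_of_pos hlam0 _
  set h := (K * lam ^ (-q)) ^ (1 / (N : ℝ)) with hh
  have hh0 : 0 < h := by positivity
  have hhN : h ^ N = K * lam ^ (-q) := by
    rw [hh, one_div, rpow_inv_natCast_pow (by positivity) hN]
  have hhs : h ^ s ≤ 1 := rpow_le_one hh0.le (hlt.le.trans (min_le_right _ _)) hs
  have hhsP : (2 * h ^ s / lam) ^ P =
      2 ^ P * K ^ (s * P / N) * lam ^ (-(P + s * P / N * q)) := by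
    have e1 : (h ^ s) ^ P = K ^ (s * P / N) * lam ^ (-(s * P / N * q)) := by
      rw [← rpow_mul hh0.le, hh, ← rpow_mul (by positivity), mul_rpow hK0.le hlq.le,
        ← rpow_mul hlam0.le]
      congr 2 <;> ring
    rw [div_rpow (by positivity) hlam0.le, mul_rpow zero_le_two (by positivity), e1, neg_add,
      rpow_add hlam0, rpow_neg hlam0.le P]
    ring
  refine (volume_superlevel_le_fracEnergy (P := P) hs hp hu hu0 hh0 (by linarith)
    (fun x hx y hy => hloc x hx y (hy.trans (hlt.trans_le (min_le_left _ _)))) ?_).trans ?_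
  · refine (hw u hu hu0 hM (lam / 2) (by linarith)).trans ?_
    rw [volume_ball_div_two 0 hh0]
    refine ENNReal.ofReal_le_ofReal (le_of_eq ?_)
    rw [hhN, ← hω, hK, div_rpow hlam0.le zero_le_two, rpow_neg zero_le_two]
    field_simp
  · refine (mul_le_mul_right hM _).trans ?_
    rw [← ENNReal.ofReal_mul (by positivity)]
    refine ENNReal.ofReal_le_ofReal (le_of_eq ?_)
    rw [hhsP]
    ring

/-- The weak type exponents reached by iteration approach the fixed point
`R = P + (s P / N) R`. -/
theorem exists_weakTypeBound_gt (hN : N ≠ 0) {Ω : Set (Euc N)} (hΩ : volume Ω ≠ ⊤) {s : ℝ}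
    (hs : 0 ≤ s) {p : Euc N × Euc N → ℝ} (hp : CPlus univ p) (M : ℝ) {P δ r R : ℝ}
    (hP : 0 ≤ P) (hδ : 0 < δ) (hloc : ∀ x ∈ Ω, ∀ y, dist x y < δ → P ≤ p (x, y))
    (hsP : s * P < N) (hR : R = P + s * P / N * R) (hrR : r < R) :
    ∃ q, r < q ∧ WeakTypeBound Ω s p M q := by
  have hN0 : 0 < (N : ℝ) := by positivity
  set θ := s * P / N with hθ
  have hθ0 : 0 ≤ θ := by positivity
  have hθ1 : θ < 1 := (div_lt_one hN0).2 hsP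
  have hPR : P ≤ R := by
    have : R * (1 - θ) = P := by linarith
    have hR0 : 0 ≤ R := nonneg_of_mul_nonneg_left (this ▸ hP) (by linarith)
    nlinarith
  rcases hP.eq_or_lt with rfl | hP0
  · have hR0 : R = 0 := by simpa [hθ] using hR
    exact ⟨1, by linarith, weakTypeBound_one hN hΩ hs hp M⟩
  have hiter : ∀ n : ℕ, ∃ q, 0 < q ∧ q = R + θ ^ n * (1 - R) ∧ WeakTypeBound Ω s p M q := by
    intro n
    induction n with
    | zero => exact ⟨1, one_pos, by simp, weakTypeBound_one hN hΩ hs hp M⟩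
    | succ n ih =>
      obtain ⟨q, hq0, hq, hw⟩ := ih
      refine ⟨P + θ * q, by positivity, ?_, hw.step hN hΩ hs hp hq0 hP hδ hloc⟩
      rw [hq, pow_succ]
      linear_combination -hR
  have hlim : Tendsto (fun n : ℕ => R + θ ^ n * (1 - R)) atTop (𝓝 R) := by
    simpa using ((tendsto_pow_atTop_nhds_zero_of_lt_one hθ0 hθ1).mul_const (1 - R)).const_add R
  obtain ⟨n, hn⟩ := (hlim.eventually_const_lt hrR).exists
  obtain ⟨q, -, hq, hw⟩ := hiter n
  exact ⟨q, hq ▸ hn, hw⟩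

end WeakType

section Compactness

theorem WeakTypeBound.lintegral_rpow_le {Ω : Set (Euc N)} (hΩ : volume Ω ≠ ⊤) {s : ℝ}
    {p : Euc N × Euc N → ℝ} {M q r : ℝ} (hr : 1 ≤ r) (hrq : r < q)
    (hw : WeakTypeBound Ω s p M q) :
    ∃ D : ENNReal, D ≠ ⊤ ∧ ∀ u : Euc N → ℝ, Measurable u → (∀ᵐ x, x ∉ Ω → u x = 0) →
      fracEnergy s p u ≤ ENNReal.ofReal M → ∫⁻ x, ENNReal.ofReal (|u x| ^ r) ≤ D := by
  obtain ⟨C, hC, hw⟩ := hw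
  have hfin : ∫⁻ t in Ioi (1 : ℝ), ENNReal.ofReal (C * t ^ (-q + (r - 1))) ≠ ⊤ := by
    have h1 : IntegrableOn (fun t : ℝ => C * t ^ (-q + (r - 1))) (Ioi 1) :=
      (integrableOn_Ioi_rpow_of_lt (by linarith) one_pos).const_mul C
    rw [← ofReal_integral_eq_lintegral_ofReal h1]
    · exact ENNReal.ofReal_ne_top
    · filter_upwards [ae_restrict_mem measurableSet_Ioi] with t ht
      have : 0 < t := one_pos.trans ht
      simp only [Pi.zero_apply]
      positivity
  refine ⟨ENNReal.ofReal r *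
    (volume Ω + ∫⁻ t in Ioi (1 : ℝ), ENNReal.ofReal (C * t ^ (-q + (r - 1)))),
    ENNReal.mul_ne_top ENNReal.ofReal_ne_top (ENNReal.add_ne_top.2 ⟨hΩ, hfin⟩),
    fun u hu hu0 hM => ?_⟩
  rw [lintegral_rpow_eq_lintegral_meas_lt_mul volume
    (Eventually.of_forall fun x => abs_nonneg (u x)) (by fun_prop) (by linarith)]
  gcongr
  rw [← Ioc_union_Ioi_eq_Ioi (zero_le_one (α := ℝ)),
    lintegral_union measurableSet_Ioi (Ioc_disjoint_Ioi le_rfl)]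
  gcongr ?_ + ?_
  · calc ∫⁻ t in Ioc (0 : ℝ) 1, volume {a | t < |u a|} * ENNReal.ofReal (t ^ (r - 1))
        ≤ ∫⁻ _ in Ioc (0 : ℝ) 1, volume Ω := by
          refine setLIntegral_mono' measurableSet_Ioc fun t ht => ?_
          refine (mul_le_mul' (volume_superlevel_le hu0 ht.1.le)
            (ENNReal.ofReal_le_one.2 (rpow_le_one ht.1.le ht.2 (by linarith)))).trans_eq ?_
          rw [mul_one]
      _ = volume Ω := by simp
  · refine setLIntegral_mono' measurableSet_Ioi fun t ht => ?_
    have ht1 : (1 : ℝ) < t := ht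
    have ht0 : 0 < t := by linarith
    calc volume {a | t < |u a|} * ENNReal.ofReal (t ^ (r - 1))
        ≤ ENNReal.ofReal (C * t ^ (-q)) * ENNReal.ofReal (t ^ (r - 1)) := by
          gcongr; exact hw u hu hu0 hM t ht1.le
      _ = ENNReal.ofReal (C * t ^ (-q + (r - 1))) := by
          rw [← ENNReal.ofReal_mul (by positivity), rpow_add ht0, mul_assoc]

/-- Weak convergence in `X₀` implies convergence of the integrals over measurable sets. -/
theorem WeakTendstoX0.tendsto_setIntegral (hN : N ≠ 0) {Ω : Set (Euc N)}
    (hΩo : MeasurableSet Ω) (hΩb : Bornology.IsBounded Ω) {s : ℝ} (hs : 0 ≤ s)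
    {p : Euc N × Euc N → ℝ} (hp : CPlus univ p) {um : ℕ → Euc N → ℝ} {u : Euc N → ℝ}
    (hum : ∀ m, ∀ᵐ x, x ∉ Ω → um m x = 0) (hu : ∀ᵐ x, x ∉ Ω → u x = 0)
    (hw : WeakTendstoX0 s p um u) {A : Set (Euc N)} (hA : MeasurableSet A) :
    Tendsto (fun m => ∫ x in A, um m x) atTop (𝓝 (∫ x in A, u x)) := by
  obtain ⟨R, hR0, hR⟩ := hΩb.exists_pos_norm_le
  set y₀ : Euc N := EuclideanSpace.single ⟨0, Nat.pos_of_ne_zero hN⟩ (R + 2) with hy₀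
  have hy₀n : ‖y₀‖ = R + 2 := by
    simp [hy₀, abs_of_nonneg (show 0 ≤ R + 2 by linarith)]
  set E := Metric.ball y₀ 1 with hE
  have hEm : MeasurableSet E := measurableSet_ball
  have hdist : ∀ x ∈ Ω, ∀ y ∈ E, 1 ≤ ‖x - y‖ ∧ ‖x - y‖ ≤ 2 * R + 3 := by
    intro x hx y hy
    have h1 := hR x hx
    have h2 : ‖y - y₀‖ < 1 := by rw [← dist_eq_norm]; exact hy
    have h3 := norm_sub_norm_le y₀ y
    have h4 := norm_sub_norm_le y y₀
    have h5 := norm_sub_norm_le y x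
    have h6 := norm_sub_le x y
    rw [norm_sub_rev y₀ y] at h3
    rw [norm_sub_rev y x] at h5
    constructor <;> linarith
  have hEΩ : ∀ y ∈ E, y ∉ Ω := fun y hy hyΩ => by
    have := (hdist y hyΩ y hy).1
    simp at this
    linarith
  set k : Euc N × Euc N → ℝ := fun z => ‖z.1 - z.2‖ ^ ((N : ℝ) + s * p z) with hk
  have hpm := hp.continuous.measurable
  have hkm : Measurable k := by fun_prop
  set S := (A ∩ Ω) ×ˢ E with hS
  have hSm : MeasurableSet S := (hA.inter hΩo).prod hEm
  have hSfin : volume S < ⊤ := by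
    rw [hS, Measure.volume_eq_prod, Measure.prod_prod]
    exact ENNReal.mul_lt_top ((measure_mono inter_subset_right).trans_lt hΩb.measure_lt_top)
      measure_ball_lt_top
  have hkS : ∀ z ∈ S, 1 ≤ k z ∧ k z ≤ (2 * R + 3) ^ ((N : ℝ) + s * supOn p univ) := by
    rintro ⟨x, y⟩ ⟨hx, hy⟩
    obtain ⟨h1, h2⟩ := hdist x hx.2 y hy
    have hpz : 1 < p (x, y) := hp.one_lt (mem_univ _)
    refine ⟨one_le_rpow h1 (by positivity), ?_⟩
    refine (rpow_le_rpow (norm_nonneg _) h2 (by positivity)).trans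
      (rpow_le_rpow_of_exponent_le (by linarith) ?_)
    gcongr
    exact hp.le_supOn (mem_univ _)
  set K := (2 * R + 3) ^ ((N : ℝ) + s * supOn p univ) with hK
  set a := infOn p univ - 1 with ha
  have ha0 : 0 < a := by have := hp.2.1; linarith
  have htest := hw (S.indicator k) (hkm.indicator hSm) (by
    refine Integrable.mono' (g := S.indicator fun _ => K ^ (1 + 1 / a)) ?_ ?_ ?_
    · exact (integrable_indicator_iff hSm).2 (integrableOn_const hSfin.ne)
    · have := hkm.indicator hSm
      exact Measurable.aestronglyMeasurable (by fun_prop)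
    · refine Eventually.of_forall fun z => ?_
      have hpz : 1 < p z := hp.one_lt (mem_univ z)
      by_cases hz : z ∈ S
      · obtain ⟨h1, h2⟩ := hkS z hz
        rw [indicator_of_mem hz, indicator_of_mem hz, abs_of_nonneg (by linarith),
          norm_of_nonneg (by positivity)]
        have hexp : p z / (p z - 1) ≤ 1 + 1 / a := by
          have h3 : a ≤ p z - 1 := by have := hp.infOn_le (mem_univ z); linarith
          have h4 : 1 / (p z - 1) ≤ 1 / a := one_div_le_one_div_of_le ha0 h3
          have h5 : p z / (p z - 1) = 1 + 1 / (p z - 1) := by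
            have : p z - 1 ≠ 0 := by linarith
            field_simp
            ring
          linarith
        have hexp0 : 0 ≤ p z / (p z - 1) := div_nonneg (by linarith) (by linarith)
        calc k z ^ (p z / (p z - 1)) / k z ≤ k z ^ (p z / (p z - 1)) :=
              div_le_self (by positivity) h1
          _ ≤ K ^ (p z / (p z - 1)) := by gcongr
          _ ≤ K ^ (1 + 1 / a) := rpow_le_rpow_of_exponent_le (h1.trans h2) hexp
      · have : p z / (p z - 1) ≠ 0 := (div_pos (by linarith) (by linarith)).ne'
        rw [indicator_of_notMem hz, indicator_of_notMem hz, abs_zero, zero_rpow this]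
        simp)
  have hred : ∀ w : Euc N → ℝ, (∀ᵐ x, x ∉ Ω → w x = 0) →
      ∫ z : Euc N × Euc N, (w z.1 - w z.2) * S.indicator k z /
        ‖z.1 - z.2‖ ^ ((N : ℝ) + s * p z) = (∫ x in A, w x) * volume.real E := by
    intro w hw0
    have h1 : ∫ x in A, w x = ∫ x, (A ∩ Ω).indicator w x := by
      rw [← integral_indicator hA]
      refine integral_congr_ae ?_
      filter_upwards [hw0] with x hx
      by_cases hxA : x ∈ A <;> by_cases hxΩ : x ∈ Ω <;> simp [indicator, hxA, hxΩ, hx]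
    have h2 : volume.real E = ∫ y, E.indicator (fun _ => (1 : ℝ)) y := by
      rw [integral_indicator hEm]; simp
    rw [h1, h2, ← integral_prod_mul, Measure.volume_eq_prod]
    refine integral_congr_ae ?_
    filter_upwards [Measure.quasiMeasurePreserving_snd.ae hw0] with z hz
    by_cases hzS : z ∈ S
    · have hz1 : z.1 ∈ A ∩ Ω := hzS.1
      have hz2 : z.2 ∈ E := hzS.2
      have := (hkS z hzS).1
      rw [indicator_of_mem hzS, indicator_of_mem hz1, indicator_of_mem hz2, hz (hEΩ _ hz2)]
      change (w z.1 - 0) * k z / k z = _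
      rw [mul_div_cancel_right₀ _ (by linarith)]
      ring
    · rw [indicator_of_notMem hzS, mul_zero, zero_div]
      by_cases hz1 : z.1 ∈ A ∩ Ω
      · have hz2 : z.2 ∉ E := fun h => hzS ⟨hz1, h⟩
        rw [indicator_of_notMem hz2, mul_zero]
      · rw [indicator_of_notMem hz1, zero_mul]
  have hE0 : volume.real E ≠ 0 :=
    (ENNReal.toReal_pos (Metric.measure_ball_pos _ _ one_pos).ne' measure_ball_lt_top.ne).ne'
  simp_rw [hred _ (hum _), hred _ hu] at htest
  simpa [hE0] using htest.div_const (volume.real E)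

/-- The set where `w` is large but its mean over balls of radius `h` is not has small measure. -/
theorem volume_large_of_small_mean_le {s : ℝ} (hs : 0 ≤ s) {p : Euc N × Euc N → ℝ}
    (hp : CPlus univ p) {w : Euc N → ℝ} (hw : Measurable w) (hwi : Integrable w) {ε h : ℝ}
    (hε : 0 < ε) (hh : 0 < h) (hhε : 4 * h ^ s ≤ ε) :
    volume {x | ε ≤ |w x| ∧ |∫ y in Metric.ball x h, w y| ≤
        ε / 2 * (h ^ N * volume.real (Metric.ball (0 : Euc N) 1))} ≤
      ENNReal.ofReal (4 * h ^ s / (ε * volume.real (Metric.ball (0 : Euc N) 1))) *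
        fracEnergy s p w := by
  set ω := volume.real (Metric.ball (0 : Euc N) 1) with hω
  have hω0 : 0 < ω := volume_real_unitBall_pos
  have hhs : 0 < h ^ s := rpow_pos_of_pos hh s
  have hmeas := measurable_fracDensity (s := s) hp.continuous.measurable hw
  rw [show 4 * h ^ s / (ε * ω) = (ε * ω / (4 * h ^ s))⁻¹ by rw [inv_div]]
  refine le_ofReal_inv_mul_of_ofReal_mul_le (by positivity)
    (ofReal_mul_volume_le_fracEnergy hp hw (Eventually.of_forall ?_))
  rintro x ⟨hx, hmean⟩
  set b := h ^ N * ω with hb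
  have hb0 : 0 < b := by positivity
  have hvol : volume (Metric.ball x h) = ENNReal.ofReal b := volume_ball_eq_ofReal x hh
  have hvolr : volume.real (Metric.ball x h) = b := by
    rw [measureReal_def, hvol, ENNReal.toReal_ofReal hb0.le]
  have hci : IntegrableOn (fun _ => w x) (Metric.ball x h) :=
    integrableOn_const measure_ball_lt_top.ne
  have hdi : IntegrableOn (fun y => w x - w y) (Metric.ball x h) := hci.sub hwi.integrableOn
  have hpt : ∀ y ∈ Metric.ball x h,
      |w x - w y| ≤ ε / 4 + h ^ N * h ^ s * fracDensity s p w (x, y) := by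
    intro y hy
    have hF := fracDensity_nonneg s p w (x, y)
    rcases le_or_gt |w x - w y| (ε / 4) with hd | hd
    · have : 0 ≤ h ^ N * h ^ s * fracDensity s p w (x, y) := by positivity
      linarith
    · have hxy : dist x y < h := by rw [dist_comm]; exact hy
      have hr : 0 < ‖x - y‖ := by
        rw [norm_pos_iff, sub_ne_zero]
        rintro rfl
        simp at hd
        linarith
      have hpxy := hp.one_lt (mem_univ (x, y))
      have hT : 1 ≤ |w x - w y| / h ^ s := by rw [one_le_div hhs]; linarith
      have key := div_pow_le_of_le_mul (N := N) (P := 1) hr (by rw [← dist_eq_norm]; exact hxy.le)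
        hT (div_mul_cancel₀ _ hhs.ne').le hpxy.le hs (by linarith)
      rw [rpow_one, div_div, div_le_iff₀ (by positivity)] at key
      unfold fracDensity
      dsimp only
      linarith
  have hlow : b * (ε / 2) ≤ ∫ y in Metric.ball x h, |w x - w y| := by
    have h1 : ∫ y in Metric.ball x h, (w x - w y) = b * w x - ∫ y in Metric.ball x h, w y := by
      rw [integral_sub hci hwi.integrableOn, setIntegral_const, hvolr, smul_eq_mul]
    have h2 := abs_integral_le_integral_abs (μ := volume.restrict (Metric.ball x h))
      (f := fun y => w x - w y)
    have h3 := abs_sub_abs_le_abs_sub (b * w x) (∫ y in Metric.ball x h, w y)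
    rw [abs_mul, abs_of_pos hb0] at h3
    rw [h1] at h2
    have h4 : b * ε ≤ b * |w x| := by gcongr
    linarith
  set I := ∫⁻ y, ENNReal.ofReal (fracDensity s p w (x, y)) with hI
  have hup : ENNReal.ofReal (b * (ε / 2)) ≤
      ENNReal.ofReal (b * (ε / 4)) + ENNReal.ofReal (h ^ N * h ^ s) * I := by
    calc ENNReal.ofReal (b * (ε / 2))
        ≤ ENNReal.ofReal (∫ y in Metric.ball x h, |w x - w y|) := ENNReal.ofReal_le_ofReal hlow
      _ = ∫⁻ y in Metric.ball x h, ENNReal.ofReal |w x - w y| :=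
          ofReal_integral_eq_lintegral_ofReal hdi.abs (Eventually.of_forall fun _ => abs_nonneg _)
      _ ≤ ∫⁻ y in Metric.ball x h, (ENNReal.ofReal (ε / 4) +
            ENNReal.ofReal (h ^ N * h ^ s) * ENNReal.ofReal (fracDensity s p w (x, y))) := by
          refine setLIntegral_mono' measurableSet_ball fun y hy => ?_
          rw [← ENNReal.ofReal_mul (by positivity), ← ENNReal.ofReal_add (by positivity)
            (mul_nonneg (by positivity) (fracDensity_nonneg ..))]
          exact ENNReal.ofReal_le_ofReal (hpt y hy)
      _ = ENNReal.ofReal (b * (ε / 4)) + ENNReal.ofReal (h ^ N * h ^ s) *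
            ∫⁻ y in Metric.ball x h, ENNReal.ofReal (fracDensity s p w (x, y)) := by
          rw [lintegral_add_left measurable_const, setLIntegral_const, hvol, mul_comm,
            ← ENNReal.ofReal_mul hb0.le, lintegral_const_mul _ (by fun_prop)]
      _ ≤ _ := by gcongr; exact setLIntegral_le_lintegral _ _
  have hup' : ENNReal.ofReal (b * (ε / 4)) ≤ ENNReal.ofReal (h ^ N * h ^ s) * I := by
    rw [show b * (ε / 2) = b * (ε / 4) + b * (ε / 4) by ring,
      ENNReal.ofReal_add (by positivity) (by positivity)] at hup
    exact (ENNReal.add_le_add_iff_left ENNReal.ofReal_ne_top).1 hup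
  calc ENNReal.ofReal (ε * ω / (4 * h ^ s))
      = ENNReal.ofReal (h ^ N * h ^ s)⁻¹ * ENNReal.ofReal (b * (ε / 4)) := by
        rw [← ENNReal.ofReal_mul (by positivity), hb]
        congr 1
        field_simp
    _ ≤ ENNReal.ofReal (h ^ N * h ^ s)⁻¹ * (ENNReal.ofReal (h ^ N * h ^ s) * I) := by gcongr
    _ = I := by
        rw [← mul_assoc, ← ENNReal.ofReal_mul (by positivity), inv_mul_cancel₀ (by positivity),
          ENNReal.ofReal_one, one_mul]

theorem measurable_setIntegral_ball {w : Euc N → ℝ} (hw : Measurable w) (h : ℝ) :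
    Measurable fun x => ∫ y in Metric.ball x h, w y := by
  have hS : MeasurableSet {z : Euc N × Euc N | dist z.2 z.1 < h} :=
    measurableSet_lt (by fun_prop) measurable_const
  have h1 : StronglyMeasurable ({z : Euc N × Euc N | dist z.2 z.1 < h}.indicator
      fun z => w z.2) := ((hw.comp measurable_snd).indicator hS).stronglyMeasurable
  convert (h1.integral_prod_right' (ν := volume)).measurable using 2 with x
  rw [← integral_indicator measurableSet_ball]
  rfl

/-- A sequence of bounded energy whose means over all balls tend to zero tends to zero in
measure on sets of finite measure. -/
theorem tendstoInMeasure_zero_of_tendsto_mean {Ω : Set (Euc N)} (hΩ : volume Ω ≠ ⊤) {s : ℝ}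
    (hs : 0 < s) {p : Euc N × Euc N → ℝ} (hp : CPlus univ p) {w : ℕ → Euc N → ℝ}
    (hw : ∀ m, Measurable (w m)) (hwi : ∀ m, Integrable (w m)) {M : ℝ}
    (hM : ∀ m, fracEnergy s p (w m) ≤ ENNReal.ofReal M)
    (hmean : ∀ x h, Tendsto (fun m => ∫ y in Metric.ball x h, w m y) atTop (𝓝 0)) :
    TendstoInMeasure (volume.restrict Ω) w atTop 0 := by
  have : IsFiniteMeasure (volume.restrict Ω) := ⟨by simpa using hΩ.lt_top⟩
  rw [tendstoInMeasure_iff_norm]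
  intro ε hε
  rw [ENNReal.tendsto_nhds_zero]
  intro η hη
  set ω := volume.real (Metric.ball (0 : Euc N) 1) with hω
  have hω0 : 0 < ω := volume_real_unitBall_pos
  have hη2 : 0 < η / 2 := ENNReal.half_pos hη.ne'
  have hhs : Tendsto (fun h : ℝ => h ^ s) (𝓝[>] 0) (𝓝 0) := by
    have := (continuousAt_rpow_const 0 s (Or.inr hs.le)).tendsto
    rw [zero_rpow hs.ne'] at this
    exact this.mono_left nhdsWithin_le_nhds
  have hlim : Tendsto (fun h : ℝ => ENNReal.ofReal (4 * h ^ s / (ε * ω)) * ENNReal.ofReal M)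
      (𝓝[>] 0) (𝓝 0) := by
    have h1 := ENNReal.tendsto_ofReal ((hhs.const_mul 4).div_const (ε * ω))
    rw [mul_zero, zero_div, ENNReal.ofReal_zero] at h1
    simpa using ENNReal.Tendsto.mul_const h1 (Or.inr (ENNReal.ofReal_ne_top (r := M)))
  have hsmall : Tendsto (fun h : ℝ => 4 * h ^ s) (𝓝[>] 0) (𝓝 0) := by
    simpa using hhs.const_mul 4
  obtain ⟨h, hh0, hhη, hhε⟩ := (eventually_mem_nhdsWithin.and
    ((hlim.eventually_lt_const hη2).and (hsmall.eventually_lt_const hε))).exists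
  have hh0 : 0 < h := hh0
  set b := h ^ N * ω with hb
  have hconv : TendstoInMeasure (volume.restrict Ω)
      (fun m x => ∫ y in Metric.ball x h, w m y) atTop 0 :=
    tendstoInMeasure_of_tendsto_ae
      (fun m => (measurable_setIntegral_ball (hw m) h).aestronglyMeasurable)
      (Eventually.of_forall fun x => hmean x h)
  rw [tendstoInMeasure_iff_norm] at hconv
  filter_upwards [(hconv (ε / 2 * b) (by positivity)).eventually_lt_const hη2] with m hm
  have hsub : {x | ε ≤ ‖w m x - (0 : Euc N → ℝ) x‖} ⊆
      {x | ε ≤ |w m x| ∧ |∫ y in Metric.ball x h, w m y| ≤ ε / 2 * b} ∪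
      {x | ε / 2 * b ≤ ‖(∫ y in Metric.ball x h, w m y) - (0 : Euc N → ℝ) x‖} := by
    intro x hx
    simp only [Pi.zero_apply, sub_zero, norm_eq_abs, mem_ofPred_eq, mem_union] at hx ⊢
    rcases le_total |∫ y in Metric.ball x h, w m y| (ε / 2 * b) with h' | h'
    · exact Or.inl ⟨hx, h'⟩
    · exact Or.inr h'
  calc volume.restrict Ω {x | ε ≤ ‖w m x - (0 : Euc N → ℝ) x‖}
      ≤ volume.restrict Ω {x | ε ≤ |w m x| ∧ |∫ y in Metric.ball x h, w m y| ≤ ε / 2 * b} +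
        volume.restrict Ω
          {x | ε / 2 * b ≤ ‖(∫ y in Metric.ball x h, w m y) - (0 : Euc N → ℝ) x‖} :=
        (measure_mono hsub).trans (measure_union_le _ _)
    _ ≤ η / 2 + η / 2 := by
        gcongr
        refine (Measure.restrict_apply_le _ _).trans ?_
        refine (volume_large_of_small_mean_le hs.le hp (hw m) (hwi m) hε hh0 hhε.le).trans ?_
        exact (mul_le_mul_right (hM m) _).trans hhη.le
    _ = η := ENNReal.add_halves η

end Compactness

section Vitali

theorem unifIntegrable_one_of_lintegral_rpow_le {X ι : Type*} [MeasurableSpace X]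
    {μ : Measure X} {f : ι → X → ℝ} (hf : ∀ i, AEStronglyMeasurable (f i) μ) {k : ℝ}
    (hk : 1 < k) {D : ENNReal} (hD : D ≠ ⊤)
    (h : ∀ i, ∫⁻ x, ENNReal.ofReal (|f i x| ^ k) ∂μ ≤ D) : UnifIntegrable f 1 μ := by
  refine unifIntegrable_of le_rfl ENNReal.one_ne_top hf fun ε hε => ?_
  have hlim : Tendsto (fun C : ℝ => ENNReal.ofReal (C ^ (-(k - 1))) * D) atTop (𝓝 0) := by
    have h1 := ENNReal.tendsto_ofReal (tendsto_rpow_neg_atTop (show 0 < k - 1 by linarith))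
    rw [ENNReal.ofReal_zero] at h1
    simpa using ENNReal.Tendsto.mul_const h1 (Or.inr hD)
  obtain ⟨C, hCε, hC0⟩ := ((hlim.eventually_lt_const (ENNReal.ofReal_pos.2 hε)).and
    (eventually_gt_atTop 0)).exists
  refine ⟨C.toNNReal, fun i => ?_⟩
  rw [eLpNorm_one_eq_lintegral_enorm]
  refine le_trans ?_ hCε.le
  calc ∫⁻ x, ‖{x | C.toNNReal ≤ ‖f i x‖₊}.indicator (f i) x‖ₑ ∂μ
      ≤ ∫⁻ x, ENNReal.ofReal (C ^ (-(k - 1))) * ENNReal.ofReal (|f i x| ^ k) ∂μ := by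
        refine lintegral_mono fun x => ?_
        by_cases hx : x ∈ {x | C.toNNReal ≤ ‖f i x‖₊}
        · rw [indicator_of_mem hx, ← ofReal_norm, norm_eq_abs,
            ← ENNReal.ofReal_mul (by positivity)]
          refine ENNReal.ofReal_le_ofReal ?_
          have hx' : C ≤ |f i x| := Real.toNNReal_le_iff_le_coe.1 hx
          have hf0 : 0 < |f i x| := hC0.trans_le hx'
          have h1 : |f i x| ^ k = |f i x| ^ (k - 1) * |f i x| := by
            rw [← rpow_add_one hf0.ne', sub_add_cancel]
          have h2 : C ^ (k - 1) ≤ |f i x| ^ (k - 1) := by gcongr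
          rw [h1, ← mul_assoc, rpow_neg hC0.le]
          refine le_mul_of_one_le_left hf0.le ?_
          rw [← div_eq_inv_mul, one_le_div (by positivity)]
          exact h2
        · rw [indicator_of_notMem hx]; simp
    _ = ENNReal.ofReal (C ^ (-(k - 1))) * ∫⁻ x, ENNReal.ofReal (|f i x| ^ k) ∂μ :=
        lintegral_const_mul' _ _ ENNReal.ofReal_ne_top
    _ ≤ ENNReal.ofReal (C ^ (-(k - 1))) * D := by gcongr; exact h i

theorem abs_coupled_rpow_le {c K a b α β r k t : ℝ} (hc : |c| ≤ K) (ha : 0 ≤ a) (hb : 0 ≤ b)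
    (hα : 0 ≤ α) (hβ : 0 ≤ β) (hαβ : α + β ≤ r) (hk : 0 ≤ k) (hrk : r * k ≤ t) :
    |c * a ^ α * b ^ β| ^ k ≤ K ^ k * (1 + a ^ t + b ^ t) := by
  set G := max 1 (max a b) with hG
  have hG1 : 1 ≤ G := le_max_left _ _
  have haG : a ≤ G := (le_max_left a b).trans (le_max_right _ _)
  have hbG : b ≤ G := (le_max_right a b).trans (le_max_right _ _)
  have hK : 0 ≤ K := (abs_nonneg c).trans hc
  have hat : 0 ≤ a ^ t := by positivity
  have hbt : 0 ≤ b ^ t := by positivity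
  have h1 : |c * a ^ α * b ^ β| ≤ K * G ^ r := by
    rw [abs_mul, abs_mul, abs_of_nonneg (rpow_nonneg ha α), abs_of_nonneg (rpow_nonneg hb β),
      mul_assoc]
    gcongr
    calc a ^ α * b ^ β ≤ G ^ α * G ^ β := by gcongr
      _ = G ^ (α + β) := (rpow_add (by linarith) _ _).symm
      _ ≤ G ^ r := rpow_le_rpow_of_exponent_le hG1 hαβ
  have h2 : G ^ t ≤ 1 + a ^ t + b ^ t := by
    rcases max_choice 1 (max a b) with h | h
    · rw [hG, h, one_rpow]; linarith
    · rcases max_choice a b with h' | h' <;> rw [hG, h, h'] <;> linarith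
  calc |c * a ^ α * b ^ β| ^ k ≤ (K * G ^ r) ^ k := by gcongr
    _ = K ^ k * G ^ (r * k) := by
        rw [mul_rpow hK (by positivity), ← rpow_mul (by linarith)]
    _ ≤ K ^ k * G ^ t := by gcongr
    _ ≤ _ := by gcongr

theorem lintegral_coupled_rpow_le {Ω : Set (Euc N)} (hΩ : MeasurableSet Ω) {α β c : Euc N → ℝ}
    {K r k t : ℝ} (hc : ∀ x, |c x| ≤ K) (hα : ∀ x ∈ Ω, 0 ≤ α x) (hβ : ∀ x ∈ Ω, 0 ≤ β x)
    (hαβ : ∀ x ∈ Ω, α x + β x ≤ r) (hk : 0 ≤ k) (hrk : r * k ≤ t)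
    {u v : Euc N → ℝ} (hu : Measurable u) (hv : Measurable v) {D : ENNReal}
    (hDu : ∫⁻ x, ENNReal.ofReal (|u x| ^ t) ≤ D) (hDv : ∫⁻ x, ENNReal.ofReal (|v x| ^ t) ≤ D) :
    ∫⁻ x in Ω, ENNReal.ofReal (|c x * |u x| ^ α x * |v x| ^ β x| ^ k) ≤
      ENNReal.ofReal (K ^ k) * (volume Ω + D + D) := by
  have hK : 0 ≤ K := (abs_nonneg (c 0)).trans (hc 0)
  calc ∫⁻ x in Ω, ENNReal.ofReal (|c x * |u x| ^ α x * |v x| ^ β x| ^ k)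
      ≤ ∫⁻ x in Ω, ENNReal.ofReal (K ^ k) *
          (1 + ENNReal.ofReal (|u x| ^ t) + ENNReal.ofReal (|v x| ^ t)) := by
        refine setLIntegral_mono' hΩ fun x hx => ?_
        rw [← ENNReal.ofReal_one, ← ENNReal.ofReal_add zero_le_one (by positivity),
          ← ENNReal.ofReal_add (by positivity) (by positivity),
          ← ENNReal.ofReal_mul (by positivity)]
        exact ENNReal.ofReal_le_ofReal (abs_coupled_rpow_le (hc x) (abs_nonneg _) (abs_nonneg _)
          (hα x hx) (hβ x hx) (hαβ x hx) hk hrk)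
    _ = ENNReal.ofReal (K ^ k) * (volume Ω + (∫⁻ x in Ω, ENNReal.ofReal (|u x| ^ t)) +
          ∫⁻ x in Ω, ENNReal.ofReal (|v x| ^ t)) := by
        rw [lintegral_const_mul _ (by fun_prop), lintegral_add_left (by fun_prop),
          lintegral_add_left (by fun_prop), setLIntegral_const, one_mul]
    _ ≤ _ := by
        gcongr
        · exact (setLIntegral_le_lintegral _ _).trans hDu
        · exact (setLIntegral_le_lintegral _ _).trans hDv

theorem tendsto_integral_coupled {Ω : Set (Euc N)} (hΩ : MeasurableSet Ω)
    (hΩf : volume Ω ≠ ⊤) {α β c : Euc N → ℝ} {K r t : ℝ} (hcm : Measurable c)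
    (hc : ∀ x, |c x| ≤ K) (hαc : ContinuousOn α Ω) (hβc : ContinuousOn β Ω)
    (hα : ∀ x ∈ Ω, 0 < α x) (hβ : ∀ x ∈ Ω, 0 < β x) (hαβ : ∀ x ∈ Ω, α x + β x ≤ r)
    (hr : 0 < r) (hrt : r < t) {um vm : ℕ → Euc N → ℝ} {u v : Euc N → ℝ}
    (hum : ∀ m, Measurable (um m)) (hvm : ∀ m, Measurable (vm m)) (hu : Measurable u)
    (hv : Measurable v) {D : ENNReal} (hD : D ≠ ⊤)
    (hDum : ∀ m, ∫⁻ x, ENNReal.ofReal (|um m x| ^ t) ≤ D)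
    (hDvm : ∀ m, ∫⁻ x, ENNReal.ofReal (|vm m x| ^ t) ≤ D)
    (hDu : ∫⁻ x, ENNReal.ofReal (|u x| ^ t) ≤ D) (hDv : ∫⁻ x, ENNReal.ofReal (|v x| ^ t) ≤ D)
    (hlu : TendstoInMeasure (volume.restrict Ω) um atTop u)
    (hlv : TendstoInMeasure (volume.restrict Ω) vm atTop v) :
    Tendsto (fun m => ∫ x in Ω, c x * |um m x| ^ α x * |vm m x| ^ β x) atTop
      (𝓝 (∫ x in Ω, c x * |u x| ^ α x * |v x| ^ β x)) := by
  have : IsFiniteMeasure (volume.restrict Ω) := ⟨by simpa using hΩf.lt_top⟩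
  have hαm : AEMeasurable α (volume.restrict Ω) := hαc.aemeasurable hΩ
  have hβm : AEMeasurable β (volume.restrict Ω) := hβc.aemeasurable hΩ
  have hmeas : ∀ f g : Euc N → ℝ, Measurable f → Measurable g →
      AEStronglyMeasurable (fun x => c x * |f x| ^ α x * |g x| ^ β x) (volume.restrict Ω) :=
    fun f g hf hg => AEMeasurable.aestronglyMeasurable (by fun_prop)
  have hfin : ∀ k : ℝ, ENNReal.ofReal (K ^ k) * (volume Ω + D + D) ≠ ⊤ := fun k =>
    ENNReal.mul_ne_top ENNReal.ofReal_ne_top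
      (ENNReal.add_ne_top.2 ⟨ENNReal.add_ne_top.2 ⟨hΩf, hD⟩, hD⟩)
  have hint : ∀ f g : Euc N → ℝ, Measurable f → Measurable g →
      ∫⁻ x, ENNReal.ofReal (|f x| ^ t) ≤ D → ∫⁻ x, ENNReal.ofReal (|g x| ^ t) ≤ D →
      Integrable (fun x => c x * |f x| ^ α x * |g x| ^ β x) (volume.restrict Ω) := by
    intro f g hf hg hDf hDg
    refine ⟨hmeas f g hf hg, ?_⟩
    have h1 := lintegral_coupled_rpow_le (k := 1) hΩ hc (fun x hx => (hα x hx).le)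
      (fun x hx => (hβ x hx).le) hαβ zero_le_one (by linarith) hf hg hDf hDg
    simp_rw [rpow_one (|_|)] at h1
    rw [hasFiniteIntegral_iff_norm]
    exact h1.trans_lt (hfin 1).lt_top
  refine tendsto_of_subseq_tendsto fun ns hns => ?_
  obtain ⟨ms, hms, hau⟩ := TendstoInMeasure.exists_seq_tendsto_ae
    (f := fun i => um (ns i)) fun ε hε => (hlu ε hε).comp hns
  obtain ⟨ls, hls, hav⟩ := TendstoInMeasure.exists_seq_tendsto_ae
    (f := fun i => vm (ns (ms i))) fun ε hε => (hlv ε hε).comp (hns.comp hms.tendsto_atTop)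
  refine ⟨fun i => ms (ls i), ?_⟩
  have hk : 1 < t / r := (one_lt_div hr).2 hrt
  refine tendsto_integral_of_L1' _ (hmeas u v hu hv)
    (Eventually.of_forall fun i => hint _ _ (hum _) (hvm _) (hDum _) (hDvm _)) ?_
  refine tendsto_Lp_finite_of_tendsto_ae le_rfl ENNReal.one_ne_top
    (fun i => hmeas _ _ (hum _) (hvm _))
    (memLp_one_iff_integrable.2 (hint u v hu hv hDu hDv)) ?_ ?_
  · refine unifIntegrable_one_of_lintegral_rpow_le (fun i => hmeas _ _ (hum _) (hvm _)) hk
      (hfin (t / r)) fun i => ?_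
    exact lintegral_coupled_rpow_le hΩ hc (fun x hx => (hα x hx).le)
      (fun x hx => (hβ x hx).le) hαβ (by linarith)
      (by rw [mul_div_cancel₀ _ hr.ne']) (hum _) (hvm _) (hDum _) (hDvm _)
  · filter_upwards [hau, hav, ae_restrict_mem hΩ] with x hxu hxv hx
    have h1 := ((hxu.comp hls.tendsto_atTop).abs).rpow_const (p := α x) (Or.inr (hα x hx).le)
    have h2 := hxv.abs.rpow_const (p := β x) (Or.inr (hβ x hx).le)
    exact (h1.const_mul (c x)).mul h2

end Vitali

section Subcritical

/-- Near the diagonal over `Ω` the exponent `p` exceeds a constant whose critical Sobolev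
exponent is any given number below `inf p*_s`. -/
theorem exists_le_exponent_near_diagonal {Ω : Set (Euc N)} (hN : N ≠ 0)
    (hΩb : Bornology.IsBounded Ω) {s : ℝ} (hs : 0 ≤ s) {p : Euc N × Euc N → ℝ}
    (hp : CPlus univ p) (hspN : s * supOn p univ < N) {R : ℝ} (hR : 0 ≤ R)
    (hRp : R < infOn (pstar N s p) (closure Ω)) :
    ∃ δ > 0, ∀ x ∈ Ω, ∀ y, dist x y < δ → R * N / (N + s * R) ≤ p (x, y) := by
  have hN0 : 0 < (N : ℝ) := by positivity
  have hden : ∀ x : Euc N, 0 < (N : ℝ) - s * p (x, x) := fun x => by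
    have := mul_le_mul_of_nonneg_left (hp.le_supOn (mem_univ (x, x))) hs
    linarith
  have hdiag : ∀ x ∈ closure Ω, R * N / (N + s * R) < p (x, x) := by
    intro x hx
    have hb : BddBelow (pstar N s p '' closure Ω) := by
      refine ⟨0, ?_⟩
      rintro _ ⟨y, -, rfl⟩
      have := hp.one_lt (mem_univ (y, y))
      exact div_nonneg (by positivity) (hden y).le
    have h1 : R < pstar N s p x := hRp.trans_le (csInf_le hb (mem_image_of_mem _ hx))
    rw [pstar, lt_div_iff₀ (hden x)] at h1
    rw [div_lt_iff₀ (by positivity)]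
    linarith
  have hK : IsCompact ((fun x : Euc N => (x, x)) '' closure Ω) :=
    hΩb.isCompact_closure.image (by fun_prop)
  obtain ⟨δ, hδ, hsub⟩ := hK.exists_thickening_subset_open
    (isOpen_lt continuous_const hp.continuous : IsOpen {z | R * N / (N + s * R) < p z})
    (by rintro _ ⟨x, hx, rfl⟩; exact hdiag x hx)
  refine ⟨δ, hδ, fun x hx y hxy => ?_⟩
  have hmem : (x, y) ∈ Metric.thickening δ ((fun x : Euc N => (x, x)) '' closure Ω) := by
    refine Metric.mem_thickening_iff.2 ⟨(x, x), mem_image_of_mem _ (subset_closure hx), ?_⟩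
    rw [Prod.dist_eq, dist_self, dist_comm y x]
    exact max_lt hδ hxy
  exact le_of_lt (hsub hmem)

/-- Weak convergence with bounded energy implies convergence in measure. -/
theorem WeakTendstoX0.tendstoInMeasure (hN : N ≠ 0) {Ω : Set (Euc N)}
    (hΩo : MeasurableSet Ω) (hΩb : Bornology.IsBounded Ω) {s : ℝ} (hs : 0 < s)
    {p : Euc N × Euc N → ℝ} (hp : CPlus univ p) {um : ℕ → Euc N → ℝ} {u : Euc N → ℝ}
    (hum : ∀ m, MemX0 Ω s p (um m)) (hu : MemX0 Ω s p u) {M : ℝ} (hM : 0 ≤ M)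
    (hMum : ∀ m, fracEnergy s p (um m) ≤ ENNReal.ofReal M)
    (hMu : fracEnergy s p u ≤ ENNReal.ofReal M)
    (hium : ∀ m, Integrable (um m)) (hiu : Integrable u) (hw : WeakTendstoX0 s p um u) :
    TendstoInMeasure (volume.restrict Ω) um atTop u := by
  have key := tendstoInMeasure_zero_of_tendsto_mean (w := fun m x => um m x - u x)
    (M := 2 ^ supOn p univ * (M + M)) hΩb.measure_lt_top.ne hs hp
    (fun m => (hum m).1.sub hu.1) (fun m => (hium m).sub hiu) (fun m => ?_) fun x h => ?_
  · rw [tendstoInMeasure_iff_norm] at key ⊢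
    simpa using key
  · refine (fracEnergy_sub_le hp (hum m).1 hu.1).trans ?_
    rw [ENNReal.ofReal_mul (by positivity), ENNReal.ofReal_add hM hM]
    gcongr
    exact hMum m
  · have h1 := hw.tendsto_setIntegral hN hΩo hΩb hs.le hp (fun m => (hum m).2.1) hu.2.1
      (measurableSet_ball (x := x) (ε := h))
    have h2 : ∀ m, ∫ y in Metric.ball x h, (um m y - u y) =
        (∫ y in Metric.ball x h, um m y) - ∫ y in Metric.ball x h, u y := fun m =>
      integral_sub (hium m).integrableOn hiu.integrableOn
    simp_rw [h2]
    simpa using h1.sub_const (∫ y in Metric.ball x h, u y)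

end Subcritical

/-- compactness of the coupled nonlinear term along bounded weakly
convergent sequences in `X₀`. -/
theorem coupled_term_compactness
    (N : ℕ) (hN : 2 ≤ N) (Ω : Set (Euc N))
    (hΩo : IsOpen Ω) (hΩb : Bornology.IsBounded Ω) (hΩne : Ω.Nonempty)
    (s : ℝ) (hs0 : 0 < s) (hs1 : s < 1)
    (p : Euc N × Euc N → ℝ) (hp : CPlus univ p)
    (hpsym : ∀ x y : Euc N, p (x, y) = p (y, x))
    (hspN : s * supOn p univ < (N : ℝ))
    (α β : Euc N → ℝ) (hα : CPlus (closure Ω) α) (hβ : CPlus (closure Ω) β)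
    (hpab : supOn p univ < infOn α (closure Ω) + infOn β (closure Ω))
    (habp : supOn α (closure Ω) + supOn β (closure Ω) < infOn (pstar N s p) (closure Ω))
    (c : Euc N → ℝ) (hcm : Measurable c) (hc0 : ∀ x, 0 ≤ c x) (hcb : ∃ M : ℝ, ∀ x, c x ≤ M)
    (um vm : ℕ → Euc N → ℝ) (u v : Euc N → ℝ)
    (hum : ∀ m, MemX0 Ω s p (um m)) (hvm : ∀ m, MemX0 Ω s p (vm m))
    (hu : MemX0 Ω s p u) (hv : MemX0 Ω s p v)
    (hbdd : ∃ B : ℝ, ∀ m, X0Norm s p (um m) ≤ B ∧ X0Norm s p (vm m) ≤ B)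
    (hwu : WeakTendstoX0 s p um u) (hwv : WeakTendstoX0 s p vm v) :
    Tendsto (fun m => ∫ x in Ω, c x * |um m x| ^ α x * |vm m x| ^ β x) atTop
      (𝓝 (∫ x in Ω, c x * |u x| ^ α x * |v x| ^ β x)) := by
  have hN0 : N ≠ 0 := by omega
  have hNr : 0 < (N : ℝ) := by positivity
  have hΩm : MeasurableSet Ω := hΩo.measurableSet
  have hΩf : volume Ω ≠ ⊤ := hΩb.measure_lt_top.ne
  obtain ⟨B, hB⟩ := hbdd
  obtain ⟨c₁, hc₁⟩ := hcb
  set r := supOn α (closure Ω) + supOn β (closure Ω) with hr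
  have hαβ : ∀ x ∈ Ω, α x + β x ≤ r := fun x hx =>
    add_le_add (hα.le_supOn (subset_closure hx)) (hβ.le_supOn (subset_closure hx))
  have hα1 : ∀ x ∈ Ω, 1 < α x := fun x hx => hα.one_lt (subset_closure hx)
  have hβ1 : ∀ x ∈ Ω, 1 < β x := fun x hx => hβ.one_lt (subset_closure hx)
  have hr1 : 1 < r := by
    obtain ⟨x, hx⟩ := hΩne
    linarith [hαβ x hx, hα1 x hx, hβ1 x hx]
  obtain ⟨R, hrR, hRp⟩ := exists_between habp
  have hR0 : 0 < R := by linarith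
  obtain ⟨δ, hδ, hloc⟩ :=
    exists_le_exponent_near_diagonal hN0 hΩb hs0.le hp hspN hR0.le hRp
  set b := max 1 (max B (max (X0Norm s p u) (X0Norm s p v))) + 1 with hb
  have hb1 : 1 ≤ b := by linarith [le_max_left 1 (max B (max (X0Norm s p u) (X0Norm s p v)))]
  have hbB : max B (max (X0Norm s p u) (X0Norm s p v)) < b :=
    (le_max_right _ _).trans_lt (lt_add_one _)
  set M := b ^ supOn p univ with hM
  have hM0 : 0 ≤ M := by positivity
  have hMum : ∀ m, fracEnergy s p (um m) ≤ ENNReal.ofReal M := fun m =>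
    fracEnergy_le_of_X0Norm_le hp (hum m) hb1
      (((hB m).1.trans (le_max_left _ _)).trans_lt hbB)
  have hMvm : ∀ m, fracEnergy s p (vm m) ≤ ENNReal.ofReal M := fun m =>
    fracEnergy_le_of_X0Norm_le hp (hvm m) hb1
      (((hB m).2.trans (le_max_left _ _)).trans_lt hbB)
  have hMu : fracEnergy s p u ≤ ENNReal.ofReal M :=
    fracEnergy_le_of_X0Norm_le hp hu hb1
      (((le_max_left _ _).trans (le_max_right _ _)).trans_lt hbB)
  have hMv : fracEnergy s p v ≤ ENNReal.ofReal M :=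
    fracEnergy_le_of_X0Norm_le hp hv hb1
      (((le_max_right _ _).trans (le_max_right _ _)).trans_lt hbB)
  obtain ⟨q, hrq, hq⟩ := exists_weakTypeBound_gt (r := r) (R := R) hN0 hΩf hs0.le hp M
    (P := R * N / (N + s * R)) (by positivity) hδ hloc
    (by rw [mul_div_assoc', div_lt_iff₀ (by positivity)]; nlinarith)
    (by field_simp) hrR
  obtain ⟨t, hrt, htq⟩ := exists_between hrq
  obtain ⟨D, hD, hDt⟩ := hq.lintegral_rpow_le hΩf (by linarith) htq
  obtain ⟨D₁, hD₁, hDone⟩ := hq.lintegral_rpow_le hΩf le_rfl (by linarith)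
  have hint : ∀ f : Euc N → ℝ, MemX0 Ω s p f → fracEnergy s p f ≤ ENNReal.ofReal M →
      Integrable f := by
    intro f hf hMf
    refine ⟨hf.1.aestronglyMeasurable, ?_⟩
    rw [hasFiniteIntegral_iff_norm]
    have h1 := hDone f hf.1 hf.2.1 hMf
    simp_rw [rpow_one] at h1
    exact h1.trans_lt hD₁.lt_top
  have hconv : ∀ (fm : ℕ → Euc N → ℝ) (f : Euc N → ℝ), (∀ m, MemX0 Ω s p (fm m)) →
      MemX0 Ω s p f → (∀ m, fracEnergy s p (fm m) ≤ ENNReal.ofReal M) →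
      fracEnergy s p f ≤ ENNReal.ofReal M → WeakTendstoX0 s p fm f →
      TendstoInMeasure (volume.restrict Ω) fm atTop f := fun fm f hfm hf hMfm hMf hw =>
    hw.tendstoInMeasure hN0 hΩm hΩb hs0 hp hfm hf hM0 hMfm hMf
      (fun m => hint _ (hfm m) (hMfm m)) (hint _ hf hMf)
  exact tendsto_integral_coupled hΩm hΩf hcm
    (fun x => (abs_of_nonneg (hc0 x)).trans_le (hc₁ x)) (hα.1.mono subset_closure)
    (hβ.1.mono subset_closure) (fun x hx => one_pos.trans (hα1 x hx))
    (fun x hx => one_pos.trans (hβ1 x hx)) hαβ (by linarith) hrt (fun m => (hum m).1)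
    (fun m => (hvm m).1) hu.1 hv.1 hD (fun m => hDt _ (hum m).1 (hum m).2.1 (hMum m))
    (fun m => hDt _ (hvm m).1 (hvm m).2.1 (hMvm m)) (hDt _ hu.1 hu.2.1 hMu)
    (hDt _ hv.1 hv.2.1 hMv) (hconv um u hum hu hMum hMu hwu) (hconv vm v hvm hv hMvm hMv hwv)
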